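/- arXiv:1110.3713 — 2 statements merged into one kernel-verified Lean document; each statement's English description precedes it below -/
import Mathlib

section
/- Under the stated Markov chain setup, assume: (i) for each fixed k ∈ ℕ, lim_{n→∞} g_{n,k} = 0, where g_{n,k} is the probability that the chain started at n ever visits state k; (ii) lim_{n→∞} π_{n,n} = 0; and (iii) lim_{n→∞} π_{n,n} / π_{n,M} = c for some c ∈ (0,∞). Then the number Z_n of zero decrements before absorption converges in distribution, as n → ∞, to the geometric law geom((c+1)^{−1}) on {0,1,2,…}. -/
open MeasureTheory ProbabilityTheory Filter Set

noncomputable section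

/-- The number of zero decrements of the path `x` above level `M` among its first `t` steps. -/
def zeroCount (M : ℕ) (x : ℕ → ℕ) (t : ℕ) : ℕ :=
  Nat.count (fun k => x k = x (k + 1) ∧ M < x k) t

/-- The set of times at which the path `x` has a zero decrement above level `M`. -/
def zeroTimes (M : ℕ) (x : ℕ → ℕ) : Set ℕ :=
  {k | x k = x (k + 1) ∧ M < x k}

/-- The path `x` is nonincreasing and stays at or above level `M`. -/
def IsDescending (M : ℕ) (x : ℕ → ℕ) : Prop :=
  Antitone x ∧ ∀ t, M ≤ x t

lemma zeroCount_congr {M t : ℕ} {x y : ℕ → ℕ} (h : ∀ l ≤ t, x l = y l) :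
    zeroCount M x t = zeroCount M y t := by
  unfold zeroCount
  rw [Nat.count_eq_card_filter_range, Nat.count_eq_card_filter_range]
  congr 1
  apply Finset.filter_congr
  intro k hk
  have hk' := Finset.mem_range.1 hk
  rw [h k (by omega), h (k + 1) (by omega)]

lemma zeroCount_succ_of_mem {M t : ℕ} {x : ℕ → ℕ} (h : t ∈ zeroTimes M x) :
    zeroCount M x (t + 1) = zeroCount M x t + 1 := by
  unfold zeroCount
  rw [Nat.count_succ, if_pos (show x t = x (t + 1) ∧ M < x t from h)]

lemma zeroCount_le_encard (M : ℕ) (x : ℕ → ℕ) (t : ℕ) :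
    (zeroCount M x t : ℕ∞) ≤ (zeroTimes M x).encard := by
  unfold zeroCount
  rw [Nat.count_eq_card_filter_range, ← Set.encard_coe_eq_coe_finsetCard]
  apply Set.encard_le_encard
  intro k hk
  exact (Finset.mem_filter.1 (Finset.mem_coe.1 hk)).2

lemma succ_le_encard_zeroTimes_iff (M : ℕ) (x : ℕ → ℕ) (m : ℕ) :
    ((m + 1 : ℕ) : ℕ∞) ≤ (zeroTimes M x).encard ↔
      ∃ t, (zeroCount M x t = m ∧ M < x t) ∧ x (t + 1) = x t := by
  constructor
  · intro h
    have hn : ∀ hf : (Set.ofPred fun k => x k = x (k + 1) ∧ M < x k).Finite, m < hf.toFinset.card := by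
      intro hf
      have h' : ((m + 1 : ℕ) : ℕ∞) ≤ hf.toFinset.card := by
        rw [← hf.encard_eq_coe_toFinset_card]
        exact h
      exact_mod_cast h'
    have hmem := Nat.nth_mem m hn
    exact ⟨_, ⟨Nat.count_nth hn, hmem.2⟩, hmem.1.symm⟩
  · rintro ⟨t, ⟨ht, hM⟩, hx⟩
    have := zeroCount_le_encard M x (t + 1)
    rwa [zeroCount_succ_of_mem ⟨hx.symm, hM⟩, ht] at this

lemma zeroCount_injOn {M s t : ℕ} {x : ℕ → ℕ} (hs : s ∈ zeroTimes M x) (ht : t ∈ zeroTimes M x)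
    (h : zeroCount M x s = zeroCount M x t) : s = t :=
  Nat.count_injective (p := fun k => x k = x (k + 1) ∧ M < x k) hs ht h

lemma IsDescending.eq_of_zeroCount_eq {M s t : ℕ} {x : ℕ → ℕ} (hx : IsDescending M x)
    (hM : M < x s) (hst : x s = x t) (h : zeroCount M x s = zeroCount M x t) : s = t := by
  wlog hlt : s < t generalizing s t
  · rcases Nat.lt_trichotomy s t with h1 | h1 | h1
    · exact absurd h1 hlt
    · exact h1
    · exact (this (hst ▸ hM) hst.symm h.symm h1).symm
  exfalso
  have h1 : x (s + 1) ≤ x s := hx.1 (Nat.le_succ s)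
  have h2 : x t ≤ x (s + 1) := hx.1 hlt
  have h3 := zeroCount_succ_of_mem (M := M) (x := x) (t := s) ⟨by omega, hM⟩
  have h4 : zeroCount M x (s + 1) ≤ zeroCount M x t := Nat.count_monotone _ hlt
  omega

lemma IsDescending.eq_of_hits {M s t : ℕ} {x : ℕ → ℕ} (hx : IsDescending M x)
    (hs : M < x s) (hs' : x (s + 1) = M) (ht : M < x t) (ht' : x (t + 1) = M) : s = t := by
  by_contra hne
  rcases Nat.lt_or_gt_of_ne hne with h | h
  · have : x t ≤ x (s + 1) := hx.1 h
    omega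
  · have : x s ≤ x (t + 1) := hx.1 h
    omega

lemma IsDescending.encard_zeroTimes_eq {M t : ℕ} {x : ℕ → ℕ} (hx : IsDescending M x)
    (ht : M < x t) (ht' : x (t + 1) = M) : (zeroTimes M x).encard = zeroCount M x t := by
  refine le_antisymm ?_ (zeroCount_le_encard M x t)
  unfold zeroCount
  rw [Nat.count_eq_card_filter_range, ← Set.encard_coe_eq_coe_finsetCard]
  apply Set.encard_le_encard
  rintro k ⟨hk, hk'⟩
  have hkt : k < t := by
    by_contra hge
    rcases Nat.eq_or_lt_of_le (Nat.le_of_not_lt hge) with h | h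
    · subst h
      omega
    · have : x k ≤ x (t + 1) := hx.1 h
      omega
  simpa using ⟨hkt, hk, hk'⟩

lemma IsDescending.exists_eq_of_encard_ne_top {M : ℕ} {x : ℕ → ℕ} (hx : IsDescending M x)
    (h : (zeroTimes M x).encard ≠ ⊤) : ∃ T, x T = M := by
  by_contra! hne
  apply h
  obtain ⟨N, hN⟩ : ∃ N, ∀ t, x N ≤ x t := by
    obtain ⟨_, ⟨N, rfl⟩, hN⟩ :=
      (wellFounded_lt (α := ℕ)).has_min (range x) ⟨x 0, 0, rfl⟩
    exact ⟨N, fun t => not_lt.1 (hN _ ⟨t, rfl⟩)⟩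
  rw [Set.encard_eq_top_iff]
  refine (Set.Ici_infinite N).mono fun t ht => ⟨?_, lt_of_le_of_ne (hx.2 t) (hne t).symm⟩
  exact le_antisymm ((hx.1 ht).trans (hN _)) (hx.1 (Nat.le_succ t))

lemma IsDescending.encard_zeroTimes_eq_iff {M : ℕ} {x : ℕ → ℕ} (hx : IsDescending M x)
    (h0 : M < x 0) (m : ℕ) :
    (zeroTimes M x).encard = m ↔ ∃ t, (zeroCount M x t = m ∧ M < x t) ∧ x (t + 1) = M := by
  constructor
  · intro h
    have hex := hx.exists_eq_of_encard_ne_top (by rw [h]; exact ENat.natCast_ne_top m)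
    have hT := Nat.find_spec hex
    obtain ⟨t, ht⟩ : ∃ t, Nat.find hex = t + 1 := by
      refine Nat.exists_eq_succ_of_ne_zero fun h1 => ?_
      rw [h1] at hT
      omega
    rw [ht] at hT
    have hlt : M < x t :=
      lt_of_le_of_ne (hx.2 t) (Ne.symm (Nat.find_min hex (by omega)))
    refine ⟨t, ⟨?_, hlt⟩, hT⟩
    rw [hx.encard_zeroTimes_eq hlt hT] at h
    exact_mod_cast h
  · rintro ⟨t, ⟨ht, hlt⟩, hT⟩
    rw [hx.encard_zeroTimes_eq hlt hT, ht]

section Chain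

variable {Ω : Type} {Y : ℕ → Ω → ℕ}

/-- The path `f` up to time `t`, frozen afterwards. -/
def extendPath {t : ℕ} (f : Fin (t + 1) → ℕ) (l : ℕ) : ℕ :=
  f ⟨min l t, by omega⟩

lemma path_event_eq_preimage {t : ℕ} {Q : (ℕ → ℕ) → Prop}
    (hQ : ∀ x y : ℕ → ℕ, (∀ l ≤ t, x l = y l) → Q x → Q y) :
    {ω | Q fun l => Y l ω} =
      (fun ω => fun l : Fin (t + 1) => Y l ω) ⁻¹' {f | Q (extendPath f)} := by
  ext ω
  have h : ∀ l ≤ t, Y l ω = extendPath (fun l : Fin (t + 1) => Y l ω) l := by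
    intro l hl
    simp [extendPath, min_eq_left hl]
  exact ⟨hQ _ _ h, hQ _ _ fun l hl => (h l hl).symm⟩

variable [MeasurableSpace Ω]

/-- The expected number of visits of `Y` to a state `k > M` at times when exactly `m` zero
decrements have occurred. -/
def expectedVisits (P : Measure Ω) (M : ℕ) (Y : ℕ → Ω → ℕ) (m k : ℕ) : ENNReal :=
  ∑' t, P {ω | (zeroCount M (fun l => Y l ω) t = m ∧ M < Y t ω) ∧ Y t ω = k}

/-- The one-step Markov property of `Y` with transition probabilities `π`. -/
def HasTransitions (P : Measure Ω) (π : ℕ → ℕ → ℝ) (Y : ℕ → Ω → ℕ) : Prop :=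
  ∀ (k : ℕ) (h : ℕ → ℕ) (j : ℕ),
    P {ω | (∀ l ≤ k, Y l ω = h l) ∧ Y (k + 1) ω = j}
      = P {ω | ∀ l ≤ k, Y l ω = h l} * ENNReal.ofReal (π (h k) j)

variable {P : Measure Ω} {M : ℕ} {π : ℕ → ℕ → ℝ}

lemma measurableSet_path (hY : ∀ k, Measurable (Y k)) {t : ℕ} {Q : (ℕ → ℕ) → Prop}
    (hQ : ∀ x y : ℕ → ℕ, (∀ l ≤ t, x l = y l) → Q x → Q y) :
    MeasurableSet {ω | Q fun l => Y l ω} := by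
  rw [path_event_eq_preimage hQ]
  have hH : Measurable fun ω => fun l : Fin (t + 1) => Y l ω := measurable_pi_lambda _ fun l => hY l
  exact hH (to_countable _).measurableSet

lemma HasTransitions.measure_path_step (hP : HasTransitions P π Y) (hY : ∀ k, Measurable (Y k))
    {t : ℕ} {Q : (ℕ → ℕ) → Prop}
    (hQ : ∀ x y : ℕ → ℕ, (∀ l ≤ t, x l = y l) → Q x → Q y) (i j : ℕ) (hi : ∀ x, Q x → x t = i) :
    P {ω | Q (fun l => Y l ω) ∧ Y (t + 1) ω = j} =
      P {ω | Q fun l => Y l ω} * ENNReal.ofReal (π i j) := by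
  set H : Ω → Fin (t + 1) → ℕ := fun ω l => Y l ω
  have hH : Measurable H := measurable_pi_lambda _ fun l => hY l
  set S : Set (Fin (t + 1) → ℕ) := {f | Q (extendPath f)}
  have hfib : ∀ f : Fin (t + 1) → ℕ, H ⁻¹' {f} = {ω | ∀ l ≤ t, Y l ω = extendPath f l} := by
    intro f
    ext ω
    simp only [mem_preimage, mem_singleton_iff, mem_ofPred_eq]
    constructor
    · rintro rfl l hl
      simp [extendPath, H, min_eq_left hl]
    · intro h
      ext l
      have := h l (Nat.le_of_lt_succ l.2)
      simpa [extendPath, H, min_eq_left (Nat.le_of_lt_succ l.2)] using this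
  have hQS := path_event_eq_preimage (Y := Y) hQ
  have hmeas : ∀ f ∈ S, MeasurableSet (H ⁻¹' {f}) := fun f _ => hH (measurableSet_singleton f)
  have hjm : MeasurableSet {ω | Y (t + 1) ω = j} := hY (t + 1) (measurableSet_singleton j)
  have hinter : {ω | Q (fun l => Y l ω) ∧ Y (t + 1) ω = j} =
      H ⁻¹' S ∩ {ω | Y (t + 1) ω = j} := by
    rw [← hQS]
    rfl
  rw [hinter, hQS, ← Measure.restrict_apply (hH S.to_countable.measurableSet),
    ← tsum_measure_preimage_singleton S.to_countable hmeas,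
    ← tsum_measure_preimage_singleton S.to_countable hmeas, ← ENNReal.tsum_mul_right]
  refine tsum_congr fun f => ?_
  rw [Measure.restrict_apply (hmeas f f.2), hfib]
  have := hP t (extendPath f.1) j
  rw [hi _ f.2] at this
  exact this

lemma transition_below_eq_zero (hπnonneg : ∀ i j, 0 ≤ π i j) (hπrow : ∀ i ≥ M, ∑' j, π i j = 1)
    (hπlow : ∀ i, M + 1 ≤ i → ∀ j < M, π i j = 0) (hπabs : π M M = 1)
    {i j : ℕ} (hi : M ≤ i) (hj : j < M) : π i j = 0 := by
  rcases Nat.eq_or_lt_of_le hi with rfl | h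
  · have hs : Summable fun j => π M j := by
      by_contra hs
      have := hπrow M le_rfl
      rw [tsum_eq_zero_of_not_summable hs] at this
      norm_num at this
    have := hs.sum_le_tsum {M, j} fun _ _ => hπnonneg _ _
    rw [hπrow M le_rfl, Finset.sum_pair hj.ne', hπabs] at this
    linarith [hπnonneg M j]
  · exact hπlow i h j hj

lemma transition_le_one (hπnonneg : ∀ i j, 0 ≤ π i j) (hπrow : ∀ i ≥ M, ∑' j, π i j = 1)
    {i : ℕ} (hi : M ≤ i) (j : ℕ) : π i j ≤ 1 := by
  have hs : Summable fun j => π i j := by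
    by_contra hs
    have := hπrow i hi
    rw [tsum_eq_zero_of_not_summable hs] at this
    norm_num at this
  rw [← hπrow i hi]
  exact hs.le_tsum j fun _ _ => hπnonneg _ _

lemma HasTransitions.ae_step (hP : HasTransitions P π Y) (hY : ∀ k, Measurable (Y k)) :
    ∀ᵐ ω ∂P, ∀ t, π (Y t ω) (Y (t + 1) ω) ≠ 0 := by
  rw [ae_all_iff]
  intro t
  have : ∀ᵐ ω ∂P, ∀ p : ℕ × ℕ, π p.1 p.2 = 0 → ¬ (Y t ω = p.1 ∧ Y (t + 1) ω = p.2) := by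
    rw [ae_all_iff]
    rintro ⟨i, j⟩
    by_cases h : π i j = 0
    · have h0 := hP.measure_path_step hY (t := t) (Q := fun x => x t = i)
        (fun x y h => by simp [h t le_rfl]) i j fun x hx => hx
      rw [h, ENNReal.ofReal_zero, mul_zero] at h0
      filter_upwards [measure_eq_zero_iff_ae_notMem.1 h0] with ω hω _
      exact hω
    · exact ae_of_all _ fun ω h' => absurd h' h
  filter_upwards [this] with ω hω h
  exact hω (_, _) h ⟨rfl, rfl⟩

lemma HasTransitions.ae_isDescending (hP : HasTransitions P π Y) (hY : ∀ k, Measurable (Y k))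
    (hup : ∀ i j, i < j → π i j = 0) (hlow : ∀ i j, M ≤ i → j < M → π i j = 0)
    (h0 : ∀ ω, M ≤ Y 0 ω) : ∀ᵐ ω ∂P, IsDescending M fun t => Y t ω := by
  filter_upwards [hP.ae_step hY] with ω hω
  refine ⟨antitone_nat_of_succ_le fun t => ?_, fun t => ?_⟩
  · by_contra h
    exact hω t (hup _ _ (not_le.1 h))
  · induction t with
    | zero => exact h0 ω
    | succ t ih =>
      by_contra h
      exact hω t (hlow _ _ ih (not_le.1 h))

lemma zeroCount_state_congr {m k t : ℕ} (x y : ℕ → ℕ) (h : ∀ l ≤ t, x l = y l)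
    (hx : (zeroCount M x t = m ∧ M < x t) ∧ x t = k) :
    (zeroCount M y t = m ∧ M < y t) ∧ y t = k := by
  rwa [← zeroCount_congr h, ← h t le_rfl]

lemma HasTransitions.measure_eq_tsum (hP : HasTransitions P π Y) (hY : ∀ k, Measurable (Y k))
    (m : ℕ) (φ : ℕ → ℕ) (E : Set Ω)
    (hE : ∀ᵐ ω ∂P, ω ∈ E ↔ ∃ t, (zeroCount M (fun l => Y l ω) t = m ∧ M < Y t ω) ∧
      Y (t + 1) ω = φ (Y t ω))
    (huniq : ∀ᵐ ω ∂P, ∀ s t, ((zeroCount M (fun l => Y l ω) s = m ∧ M < Y s ω) ∧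
      Y (s + 1) ω = φ (Y s ω)) → ((zeroCount M (fun l => Y l ω) t = m ∧ M < Y t ω) ∧
      Y (t + 1) ω = φ (Y t ω)) → s = t) :
    P E = ∑' k, expectedVisits P M Y m k * ENNReal.ofReal (π k (φ k)) := by
  set S : ℕ × ℕ → Set Ω := fun p => {ω | ((zeroCount M (fun l => Y l ω) p.1 = m ∧ M < Y p.1 ω) ∧
    Y p.1 ω = p.2) ∧ Y (p.1 + 1) ω = φ p.2} with hS
  have hES : E =ᵐ[P] ⋃ p, S p := by
    filter_upwards [hE] with ω hω
    apply propext
    refine hω.trans ?_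
    change _ ↔ ω ∈ ⋃ p, S p
    rw [mem_iUnion]
    constructor
    · rintro ⟨t, h1, h2⟩
      exact ⟨(t, _), ⟨h1, rfl⟩, h2⟩
    · rintro ⟨⟨t, k⟩, ⟨h1, h2⟩, h3⟩
      change Y t ω = k at h2
      subst h2
      exact ⟨t, h1, h3⟩
  have hdisj : Pairwise (Function.onFun (AEDisjoint P) S) := by
    rintro ⟨s, i⟩ ⟨t, j⟩ hne
    change P _ = 0
    rw [measure_eq_zero_iff_ae_notMem]
    filter_upwards [huniq] with ω hω
    rintro ⟨⟨⟨h1, hi⟩, h2⟩, ⟨⟨h3, hj⟩, h4⟩⟩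
    change Y s ω = i at hi
    change Y t ω = j at hj
    subst hi hj
    obtain rfl := hω s t ⟨h1, h2⟩ ⟨h3, h4⟩
    exact hne rfl
  have hmeas : ∀ p, MeasurableSet (S p) := fun p =>
    (measurableSet_path hY (t := p.1) zeroCount_state_congr).inter
      (hY (p.1 + 1) (measurableSet_singleton _))
  rw [measure_congr hES, measure_iUnion₀ hdisj fun p => (hmeas p).nullMeasurableSet,
    ENNReal.tsum_prod (f := fun t k => P (S (t, k))), ENNReal.tsum_comm]
  refine tsum_congr fun k => ?_
  rw [expectedVisits, ← ENNReal.tsum_mul_right]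
  exact tsum_congr fun t => hP.measure_path_step hY zeroCount_state_congr k (φ k) fun x hx => hx.2

lemma expectedVisits_le (hY : ∀ k, Measurable (Y k))
    (hdesc : ∀ᵐ ω ∂P, IsDescending M fun t => Y t ω) (m k : ℕ) :
    expectedVisits P M Y m k ≤ P {ω | ∃ t, Y t ω = k} := by
  rw [expectedVisits, ← measure_iUnion₀]
  · refine measure_mono (iUnion_subset fun t ω hω => ⟨t, hω.2⟩)
  · intro s t hne
    change P _ = 0
    rw [measure_eq_zero_iff_ae_notMem]
    filter_upwards [hdesc] with ω hω
    rintro ⟨⟨⟨h1, h2⟩, h3⟩, ⟨⟨h4, h5⟩, h6⟩⟩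
    exact hne (hω.eq_of_zeroCount_eq h2 (h3.trans h6.symm) (h1.trans h4.symm))
  · exact fun t => (measurableSet_path hY zeroCount_state_congr).nullMeasurableSet

lemma expectedVisits_eq_zero (m : ℕ) {k : ℕ} (hk : k ≤ M) : expectedVisits P M Y m k = 0 := by
  rw [expectedVisits, ENNReal.tsum_eq_zero]
  intro t
  convert measure_empty (μ := P)
  ext ω
  simp only [mem_ofPred_eq, mem_empty_iff_false, iff_false]
  rintro ⟨⟨_, h⟩, rfl⟩
  omega

lemma HasTransitions.measure_succ_le_encard (hP : HasTransitions P π Y)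
    (hY : ∀ k, Measurable (Y k)) (m : ℕ) :
    P {ω | ((m + 1 : ℕ) : ℕ∞) ≤ (zeroTimes M fun t => Y t ω).encard} =
      ∑' k, expectedVisits P M Y m k * ENNReal.ofReal (π k k) := by
  refine hP.measure_eq_tsum hY m id _ (ae_of_all _ fun ω => ?_) (ae_of_all _ fun ω s t hs ht => ?_)
  · exact succ_le_encard_zeroTimes_iff M _ m
  · exact zeroCount_injOn (x := fun t => Y t ω) ⟨hs.2.symm, hs.1.2⟩ ⟨ht.2.symm, ht.1.2⟩
      (hs.1.1.trans ht.1.1.symm)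

lemma HasTransitions.measure_encard_eq (hP : HasTransitions P π Y)
    (hY : ∀ k, Measurable (Y k)) (hdesc : ∀ᵐ ω ∂P, IsDescending M fun t => Y t ω)
    (h0 : ∀ ω, M < Y 0 ω) (m : ℕ) :
    P {ω | (zeroTimes M fun t => Y t ω).encard = m} =
      ∑' k, expectedVisits P M Y m k * ENNReal.ofReal (π k M) := by
  refine hP.measure_eq_tsum hY m (fun _ => M) _ ?_ ?_
  · filter_upwards [hdesc] with ω hω
    exact hω.encard_zeroTimes_eq_iff (h0 ω) m
  · filter_upwards [hdesc] with ω hω s t hs ht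
    exact hω.eq_of_hits hs.1.2 hs.2 ht.1.2 ht.2

lemma measurableSet_le_encard (hY : ∀ k, Measurable (Y k)) (m : ℕ) :
    MeasurableSet {ω | (m : ℕ∞) ≤ (zeroTimes M fun t => Y t ω).encard} := by
  cases m with
  | zero => simp
  | succ m =>
    simp_rw [succ_le_encard_zeroTimes_iff, ofPred_exists]
    refine MeasurableSet.iUnion fun t => measurableSet_path hY (t := t + 1)
      (Q := fun x => (zeroCount M x t = m ∧ M < x t) ∧ x (t + 1) = x t) fun x y h hx => ?_
    rwa [← zeroCount_congr fun l hl => h l (by omega), ← h t (by omega), ← h (t + 1) le_rfl]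

lemma measureReal_le_encard_eq_add [IsProbabilityMeasure P] (hY : ∀ k, Measurable (Y k)) (m : ℕ) :
    P.real {ω | (m : ℕ∞) ≤ (zeroTimes M fun t => Y t ω).encard} =
      P.real {ω | (zeroTimes M fun t => Y t ω).encard = m} +
        P.real {ω | ((m + 1 : ℕ) : ℕ∞) ≤ (zeroTimes M fun t => Y t ω).encard} := by
  rw [← measureReal_union _ (measurableSet_le_encard hY (m + 1))]
  · congr 1
    ext ω
    simp only [mem_ofPred_eq, mem_union]
    rw [le_iff_eq_or_lt, eq_comm, Nat.cast_add, Nat.cast_one, ENat.add_one_le_iff]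
    exact ENat.natCast_ne_top m
  · rw [Set.disjoint_left]
    intro ω h1 h2
    simp only [mem_ofPred_eq] at h1 h2
    rw [h1] at h2
    norm_cast at h2
    omega

lemma HasTransitions.abs_measureReal_sub_le [IsProbabilityMeasure P] (hP : HasTransitions P π Y)
    (hY : ∀ k, Measurable (Y k)) (hdesc : ∀ᵐ ω ∂P, IsDescending M fun t => Y t ω)
    (h0 : ∀ ω, M < Y 0 ω) (hπnonneg : ∀ i j, 0 ≤ π i j) (hπle : ∀ i j, M ≤ i → π i j ≤ 1)
    {c ε : ℝ} (hc : 0 ≤ c) (hε : 0 ≤ ε) {K : ℕ}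
    (hK : ∀ k ≥ K, |π k k - c * π k M| ≤ ε * π k M) (m : ℕ) :
    |P.real {ω | ((m + 1 : ℕ) : ℕ∞) ≤ (zeroTimes M fun t => Y t ω).encard} -
        c * P.real {ω | (zeroTimes M fun t => Y t ω).encard = m}| ≤
      ε + (1 + c) * ∑ k ∈ Finset.range K,
        if M < k then (P {ω | ∃ t, Y t ω = k}).toReal else 0 := by
  set H := expectedVisits P M Y m
  have hHle : ∀ k, H k ≤ P {ω | ∃ t, Y t ω = k} := expectedVisits_le hY hdesc m
  have hHtop : ∀ k, H k ≠ ⊤ := fun k => ((hHle k).trans_lt (measure_lt_top _ _)).ne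
  have hsum : ∀ (φ : ℕ → ℕ) (E : Set Ω), P E = ∑' k, H k * ENNReal.ofReal (π k (φ k)) →
      HasSum (fun k => (H k).toReal * π k (φ k)) (P.real E) := by
    intro φ E hE
    have h1 := ENNReal.hasSum_toReal (hE ▸ measure_ne_top P E)
    rw [← ENNReal.tsum_toReal_eq fun k => ENNReal.mul_ne_top (hHtop k) ENNReal.ofReal_ne_top,
      ← hE] at h1
    simpa [measureReal_def, ENNReal.toReal_mul, ENNReal.toReal_ofReal, hπnonneg] using h1
  have hS' := hsum id _ (hP.measure_succ_le_encard hY m)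
  have hp' := hsum (fun _ => M) _ (hP.measure_encard_eq hY hdesc h0 m)
  set p := P.real {ω | (zeroTimes M fun t => Y t ω).encard = m} 
  have hdiff := hS'.sub (hp'.mul_left c)
  have hfin : HasSum (fun k => if k ∈ Finset.range K then (H k).toReal else 0)
      (∑ k ∈ Finset.range K, (H k).toReal) := by
    have := hasSum_sum_of_ne_finset_zero (s := Finset.range K)
      (f := fun k => if k ∈ Finset.range K then (H k).toReal else 0)
      (L := .unconditional ℕ) fun k hk => if_neg hk
    rwa [Finset.sum_congr rfl fun k hk => if_pos hk] at this
  have hbound := (hp'.mul_left ε).add (hfin.mul_left (1 + c))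
  have hmain := tsum_of_norm_bounded hbound (f := fun k => (H k).toReal * π k (id k) -
      c * ((H k).toReal * π k M)) fun k => by
    have hHk : 0 ≤ (H k).toReal := ENNReal.toReal_nonneg
    have hfac : (H k).toReal * π k (id k) - c * ((H k).toReal * π k M) =
        (H k).toReal * (π k k - c * π k M) := by
      simp only [id]
      ring
    rw [hfac, Real.norm_eq_abs, abs_mul, abs_of_nonneg hHk]
    by_cases hk : k < K
    · rw [if_pos (Finset.mem_range.2 hk)]
      rcases Nat.lt_or_ge M k with hMk | hMk
      · have h1 : |π k k - c * π k M| ≤ 1 + c := by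
          have a1 := hπnonneg k k
          have a2 := hπle k k hMk.le
          have a3 := mul_nonneg hc (hπnonneg k M)
          have a4 := mul_le_mul_of_nonneg_left (hπle k M hMk.le) hc
          rw [abs_le]
          constructor <;> linarith
        have h2 := mul_le_mul_of_nonneg_left h1 hHk
        have h3 : 0 ≤ ε * ((H k).toReal * π k M) :=
          mul_nonneg hε (mul_nonneg hHk (hπnonneg k M))
        linarith
      · simp [H, expectedVisits_eq_zero m hMk]
    · rw [if_neg (by simpa using hk)]
      have := mul_le_mul_of_nonneg_left (hK k (not_lt.1 hk)) hHk
      linarith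
  rw [hdiff.tsum_eq, Real.norm_eq_abs] at hmain
  refine hmain.trans (add_le_add ?_ (mul_le_mul_of_nonneg_left ?_ (by linarith)))
  · exact mul_le_of_le_one_right hε (measureReal_le_one (μ := P))
  · refine Finset.sum_le_sum fun k _ => ?_
    split_ifs with hMk
    · exact ENNReal.toReal_mono (measure_ne_top _ _) (hHle k)
    · simp [H, expectedVisits_eq_zero m (not_lt.1 hMk)]

end Chain

lemma eventually_abs_sub_mul_le_of_tendsto_div {a b : ℕ → ℝ} {c ε : ℝ} (hb : ∀ k, 0 ≤ b k)
    (hc : 0 < c) (hε : 0 < ε) (h : Tendsto (fun k => a k / b k) atTop (nhds c)) :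
    ∀ᶠ k in atTop, |a k - c * b k| ≤ ε * b k := by
  filter_upwards [Metric.tendsto_nhds.1 h ε hε, h.eventually_ne hc.ne'] with k h1 h2
  have hbk : b k ≠ 0 := fun h0 => h2 (by simp [h0])
  rw [Real.dist_eq] at h1
  have : a k - c * b k = (a k / b k - c) * b k := by field_simp
  rw [this, abs_mul, abs_of_nonneg (hb k)]
  exact mul_le_mul_of_nonneg_right h1.le (hb k)

/-- Tails `s m` and point masses `p m` whose ratio `s (m + 1) / p m` is asymptotically `c` converge
to those of the geometric law with parameter `(c + 1)⁻¹`. -/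
lemma tendsto_geometric_of_tail {s p : ℕ → ℕ → ℝ} {c : ℝ} (hc : 0 < c)
    (hs0 : ∀ n, s 0 n = 1) (hsp : ∀ m n, s m n = p m n + s (m + 1) n)
    (h : ∀ m, Tendsto (fun n => s (m + 1) n - c * p m n) atTop (nhds 0)) (m : ℕ) :
    Tendsto (p m) atTop (nhds ((c + 1)⁻¹ * (1 - (c + 1)⁻¹) ^ m)) := by
  have hc1 : c + 1 ≠ 0 := by positivity
  have hs : ∀ m, Tendsto (s m) atTop (nhds ((1 - (c + 1)⁻¹) ^ m)) := by
    intro m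
    induction m with
    | zero => simp [funext hs0]
    | succ m ih =>
      have h1 := ((h m).add (ih.const_mul c)).const_mul (c + 1)⁻¹
      refine (h1.congr fun n => ?_).trans_eq ?_
      · rw [hsp m n]
        field_simp
        ring
      · congr 1
        rw [pow_succ]
        field_simp
        ring
  refine (((hs m).sub (hs (m + 1))).congr fun n => ?_).trans_eq ?_
  · rw [hsp m n]
    ring
  · congr 1
    rw [pow_succ]
    ring

/-- the number of zero decrements of a nonincreasing Markov chain
converges in distribution to a geometric law. -/
theorem zero_decrements_tendsto_geometric
    {Ω : Type} [MeasurableSpace Ω] (P : Measure Ω) [IsProbabilityMeasure P]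
    (M : ℕ) (π : ℕ → ℕ → ℝ)
    -- `X n` is the chain started at `n`
    (X : ℕ → ℕ → Ω → ℕ)
    (hXmeas : ∀ n k, Measurable (X n k))
    (hstart : ∀ n ≥ M, ∀ ω, X n 0 ω = n)
    -- transition probabilities: nonnegative and rows sum to one
    (hπnonneg : ∀ i j, 0 ≤ π i j)
    (hπrow : ∀ i ≥ M, ∑' j, π i j = 1)
    -- the chain is nonincreasing: no upward jumps
    (hπup : ∀ i j, i < j → π i j = 0)
    -- from a state `i ≥ M+1` only states `j` with `M ≤ j ≤ i` can be reached
    (hπlow : ∀ i, M + 1 ≤ i → ∀ j < M, π i j = 0)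
    -- the state `M` is absorbing
    (hπabs : π M M = 1)
    -- downward steps by one have positive probability, so absorption is certain
    (hπdown : ∀ i, M + 1 ≤ i → 0 < π i (i - 1))
    -- the Markov property with one-step transition probabilities `π`
    (hMarkov : ∀ n k (h : ℕ → ℕ) (j : ℕ),
      P {ω | (∀ l ≤ k, X n l ω = h l) ∧ X n (k + 1) ω = j}
        = P {ω | ∀ l ≤ k, X n l ω = h l} * ENNReal.ofReal (π (h k) j))
    -- (i) for every fixed state `k > M` the probability `g_{n,k}` that the chain
    -- started at `n` ever visits `k` tends to `0`
    (hg : ∀ k > M, Tendsto (fun n : ℕ => (P {ω | ∃ t, X n t ω = k}).toReal)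
      atTop (nhds 0))
    -- (ii)
    (hπnn : Tendsto (fun n : ℕ => π n n) atTop (nhds 0))
    -- (iii)
    (c : ℝ) (hc : 0 < c)
    (hratio : Tendsto (fun n : ℕ => π n n / π n M) atTop (nhds c)) :
    ∀ m : ℕ, Tendsto
      (fun n : ℕ => (P {ω |
          {k : ℕ | X n k ω = X n (k + 1) ω ∧ M < X n k ω}.encard = (m : ℕ∞)}).toReal)
      atTop (nhds ((c + 1)⁻¹ * (1 - (c + 1)⁻¹) ^ m)) := by
  have hlow : ∀ i j, M ≤ i → j < M → π i j = 0 := fun i j =>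
    transition_below_eq_zero hπnonneg hπrow hπlow hπabs
  have hle : ∀ i j, M ≤ i → π i j ≤ 1 := fun i j hi => transition_le_one hπnonneg hπrow hi j
  refine tendsto_geometric_of_tail
    (s := fun m n => P.real {ω | (m : ℕ∞) ≤ (zeroTimes M fun t => X n t ω).encard})
    (p := fun m n => P.real {ω | (zeroTimes M fun t => X n t ω).encard = m}) hc
    (fun n => by simp) (fun m n => measureReal_le_encard_eq_add (hXmeas n) m) fun m => ?_
  rw [Metric.tendsto_nhds]
  intro ε hε
  obtain ⟨K, hK⟩ := eventually_atTop.1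
    (eventually_abs_sub_mul_le_of_tendsto_div (fun k => hπnonneg k M) hc (half_pos hε) hratio)
  have hvisits : Tendsto (fun n => (1 + c) * ∑ k ∈ Finset.range K,
      if M < k then (P {ω | ∃ t, X n t ω = k}).toReal else 0) atTop (nhds 0) := by
    have hsum : Tendsto (fun n => ∑ k ∈ Finset.range K,
        if M < k then (P {ω | ∃ t, X n t ω = k}).toReal else 0) atTop
        (nhds (∑ k ∈ Finset.range K, 0)) := by
      refine tendsto_finsetSum _ fun k _ => ?_
      split_ifs with hk
      · exact hg k hk
      · exact tendsto_const_nhds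
    simpa using hsum.const_mul (1 + c)
  filter_upwards [hvisits.eventually_lt_const (half_pos hε), eventually_gt_atTop M] with n hn hMn
  have hP : HasTransitions P π (X n) := hMarkov n
  have h0 : ∀ ω, M < X n 0 ω := fun ω => by rwa [hstart n hMn.le ω]
  have hdesc := hP.ae_isDescending (hXmeas n) hπup hlow fun ω => (h0 ω).le
  have := hP.abs_measureReal_sub_le (hXmeas n) hdesc h0 hπnonneg hle hc.le (half_pos hε).le hK m
  rw [Real.dist_eq, sub_zero]
  linarith
end
end

section
/- Let ξ and η be positive random variables and c ∈ [0,∞]. If lim_{x↓0} P{ξ ≤ x} / P{η ≤ x} = c, then lim_{y→∞} E[e^{−yξ}] / E[e^{−yη}] = c. -/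
open MeasureTheory Filter Set
open scoped ENNReal

noncomputable section

/-- If the distribution function of `μ` is at most that of `ν` below `δ`, then the Laplace transform
of `μ` exceeds that of `ν` by at most an exponentially small term. -/
lemma lintegral_exp_neg_le_of_measure_Iic_le (μ ν : Measure ℝ) {δ y : ℝ} (hy : 0 < y)
    (h : ∀ x < δ, μ (Iic x) ≤ ν (Iic x)) :
    ∫⁻ t, ENNReal.ofReal (Real.exp (-y * t)) ∂μ ≤
      ∫⁻ t, ENNReal.ofReal (Real.exp (-y * t)) ∂ν +
        μ univ * ENNReal.ofReal (Real.exp (-y * δ)) := by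
  have hm : Measurable fun t : ℝ => Real.exp (-y * t) := by fun_prop
  have layer (ρ : Measure ℝ) : ∫⁻ t, ENNReal.ofReal (Real.exp (-y * t)) ∂ρ =
      ∫⁻ s in Ioi 0, ρ {t | s ≤ Real.exp (-y * t)} :=
    lintegral_eq_lintegral_meas_le ρ (ae_of_all _ fun t => (Real.exp_pos _).le) hm.aemeasurable
  have hlevel (s : ℝ) (hs : 0 < s) :
      {t : ℝ | s ≤ Real.exp (-y * t)} = Iic (-Real.log s / y) := by
    ext t
    rw [mem_ofPred_eq, mem_Iic, ← Real.log_le_iff_le_exp hs, le_div_iff₀ hy]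
    constructor <;> intro _ <;> linarith
  rw [layer μ, layer ν]
  calc ∫⁻ s in Ioi 0, μ {t | s ≤ Real.exp (-y * t)}
      ≤ ∫⁻ s in Ioi 0, (ν {t | s ≤ Real.exp (-y * t)} +
          (Iic (Real.exp (-y * δ))).indicator (fun _ => μ univ) s) := by
        refine setLIntegral_mono' measurableSet_Ioi fun s (hs : 0 < s) => ?_
        by_cases hsδ : s ≤ Real.exp (-y * δ)
        · rw [indicator_of_mem (mem_Iic.2 hsδ)]
          exact (measure_mono (subset_univ _)).trans le_add_self
        · refine le_add_right ?_
          rw [hlevel s hs]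
          apply h
          rw [div_lt_iff₀ hy]
          have := (Real.lt_log_iff_exp_lt hs).2 (not_le.1 hsδ)
          linarith
    _ = _ := by
        rw [lintegral_add_right _ (measurable_const.indicator measurableSet_Iic),
          lintegral_indicator_const measurableSet_Iic,
          Measure.restrict_apply measurableSet_Iic, inter_comm, Ioi_inter_Iic,
          Real.volume_Ioc, sub_zero]

/-- The Laplace transform of a measure charging every neighbourhood of the origin decays more slowly
than any exponential. -/
lemma tendsto_exp_neg_div_lintegral_exp_neg (ν : Measure ℝ)
    (hν : ∀ x : ℝ, 0 < x → ν (Iic x) ≠ 0) {δ : ℝ} (hδ : 0 < δ) :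
    Tendsto (fun y : ℝ => ENNReal.ofReal (Real.exp (-y * δ)) /
      ∫⁻ t, ENNReal.ofReal (Real.exp (-y * t)) ∂ν) atTop (nhds 0) := by
  have hlim : Tendsto (fun y : ℝ => ENNReal.ofReal (Real.exp (-y * (δ / 2))) / ν (Iic (δ / 2)))
      atTop (nhds 0) := by
    have h1 : Tendsto (fun y : ℝ => Real.exp (-y * (δ / 2))) atTop (nhds 0) :=
      Real.tendsto_exp_atBot.comp (tendsto_neg_atTop_atBot.atBot_mul_const (half_pos hδ))
    simpa using ENNReal.Tendsto.div_const (ENNReal.tendsto_ofReal h1)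
      (Or.inr (hν _ (half_pos hδ)))
  refine tendsto_of_tendsto_of_tendsto_of_le_of_le' tendsto_const_nhds hlim
    (Eventually.of_forall fun _ => zero_le) ?_
  filter_upwards [eventually_ge_atTop 0] with y hy
  have hsub : ENNReal.ofReal (Real.exp (-y * (δ / 2))) * ν (Iic (δ / 2)) ≤
      ∫⁻ t, ENNReal.ofReal (Real.exp (-y * t)) ∂ν := by
    refine le_trans ?_ (mul_meas_ge_le_lintegral (by fun_prop)
      (ENNReal.ofReal (Real.exp (-y * (δ / 2)))))
    gcongr
    intro t ht
    apply ENNReal.ofReal_le_ofReal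
    apply Real.exp_le_exp.2
    nlinarith [mem_Iic.1 ht]
  have hpos : ENNReal.ofReal (Real.exp (-y * (δ / 2))) ≠ 0 := by simp [Real.exp_pos]
  calc _ ≤ ENNReal.ofReal (Real.exp (-y * δ)) /
        (ENNReal.ofReal (Real.exp (-y * (δ / 2))) * ν (Iic (δ / 2))) := by gcongr
    _ = _ := by
      have hsplit : -y * δ = -y * (δ / 2) + -y * (δ / 2) := by ring
      rw [hsplit, Real.exp_add, ENNReal.ofReal_mul (Real.exp_pos _).le,
        ENNReal.mul_div_mul_left _ _ hpos ENNReal.ofReal_ne_top]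

/-- a Tauberian comparison lemma for Laplace transforms.
`μ` and `ν` are the laws of the positive random variables `ξ` and `η`. -/
theorem laplace_ratio_of_cdf_ratio
    (μ ν : Measure ℝ) [IsProbabilityMeasure μ] [IsProbabilityMeasure ν]
    (hμpos : μ (Set.Iic 0) = 0) (hνpos : ν (Set.Iic 0) = 0)
    (hνnz : ∀ x : ℝ, 0 < x → ν (Set.Iic x) ≠ 0)
    (c : ℝ≥0∞)
    (h : Tendsto (fun x : ℝ => μ (Set.Iic x) / ν (Set.Iic x))
      (nhdsWithin 0 (Set.Ioi 0)) (nhds c)) :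
    Tendsto (fun y : ℝ =>
        (∫⁻ t, ENNReal.ofReal (Real.exp (-y * t)) ∂μ) /
          ∫⁻ t, ENNReal.ofReal (Real.exp (-y * t)) ∂ν)
      atTop (nhds c) := by
  have null {ρ : Measure ℝ} (hρ : ρ (Iic 0) = 0) {x : ℝ} (hx : x ≤ 0) : ρ (Iic x) = 0 :=
    measure_mono_null (Iic_subset_Iic.2 hx) hρ
  rw [tendsto_order] at h ⊢
  constructor
  · intro b hb
    obtain ⟨a, haa, hac⟩ := exists_between hb
    have ha_top : a ≠ ⊤ := hac.ne_top
    obtain ⟨δ, hδ : 0 < δ, hsub⟩ := mem_nhdsGT_iff_exists_Ioo_subset.1 (h.1 a hac)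
    have hcdf : ∀ x < δ, (a • ν) (Iic x) ≤ μ (Iic x) := by
      intro x hx
      rw [Measure.smul_apply, smul_eq_mul]
      rcases le_or_gt x 0 with hx0 | hx0
      · simp [null hνpos hx0]
      · exact ENNReal.mul_le_of_le_div (hsub ⟨hx0, hx⟩ : a < _).le
    have hR := ENNReal.Tendsto.const_mul (tendsto_exp_neg_div_lintegral_exp_neg ν hνnz hδ)
      (Or.inr ha_top)
    rw [mul_zero] at hR
    filter_upwards [eventually_gt_atTop 0, hR.eventually_lt_const (tsub_pos_of_lt haa)] with y hy hRy
    have hL := lintegral_exp_neg_le_of_measure_Iic_le (a • ν) μ hy hcdf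
    rw [lintegral_smul_measure, Measure.smul_apply, measure_univ, smul_eq_mul, smul_eq_mul,
      mul_one] at hL
    have hne : ∫⁻ t, ENNReal.ofReal (Real.exp (-y * t)) ∂ν ≠ 0 := by
      intro h0
      rw [lintegral_eq_zero_iff (by fun_prop)] at h0
      have : ν univ = 0 := by
        refine measure_mono_null (fun t _ => ?_) (ae_iff.1 h0)
        simp [Real.exp_pos]
      simp at this
    have htop : ∫⁻ t, ENNReal.ofReal (Real.exp (-y * t)) ∂ν ≠ ⊤ := by
      have hle : ∫⁻ t, ENNReal.ofReal (Real.exp (-y * t)) ∂ν ≤ ∫⁻ _, 1 ∂ν := by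
        refine lintegral_mono_ae ?_
        have hpos : ∀ᵐ t ∂ν, t ∉ Iic (0 : ℝ) := measure_eq_zero_iff_ae_notMem.1 hνpos
        filter_upwards [hpos] with t ht
        have ht : 0 < t := not_le.1 ht
        rw [ENNReal.ofReal_le_one, Real.exp_le_one_iff]
        nlinarith
      exact ne_top_of_le_ne_top (by simp) hle
    by_contra! hcon
    have hdiv := ENNReal.div_le_div_right hL (∫⁻ t, ENNReal.ofReal (Real.exp (-y * t)) ∂ν)
    rw [ENNReal.mul_div_cancel_right hne htop, ENNReal.add_div, mul_div_assoc] at hdiv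
    have hlt := ENNReal.add_lt_add_of_le_of_lt haa.ne_top le_rfl hRy
    rw [add_tsub_cancel_of_le haa.le] at hlt
    exact absurd (hdiv.trans (add_le_add_left hcon _)) (not_le.2 hlt)
  · intro b hb
    obtain ⟨a, hca, haa⟩ := exists_between hb
    obtain ⟨δ, hδ : 0 < δ, hsub⟩ := mem_nhdsGT_iff_exists_Ioo_subset.1 (h.2 a hca)
    have hcdf : ∀ x < δ, μ (Iic x) ≤ (a • ν) (Iic x) := by
      intro x hx
      rw [Measure.smul_apply, smul_eq_mul]
      rcases le_or_gt x 0 with hx0 | hx0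
      · simp [null hμpos hx0]
      · exact (ENNReal.div_le_iff (hνnz x hx0) (measure_ne_top _ _)).1
          (hsub ⟨hx0, hx⟩ : _ < a).le
    have hR := tendsto_exp_neg_div_lintegral_exp_neg ν hνnz hδ
    filter_upwards [eventually_gt_atTop 0, hR.eventually_lt_const (tsub_pos_of_lt haa)] with y hy hRy
    have hL := lintegral_exp_neg_le_of_measure_Iic_le μ (a • ν) hy hcdf
    rw [lintegral_smul_measure, measure_univ, smul_eq_mul, one_mul] at hL
    have hdiv := ENNReal.div_le_div_right hL (∫⁻ t, ENNReal.ofReal (Real.exp (-y * t)) ∂ν)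
    rw [ENNReal.add_div, mul_div_assoc] at hdiv
    have hlt := ENNReal.add_lt_add_of_le_of_lt haa.ne_top le_rfl hRy
    rw [add_tsub_cancel_of_le haa.le] at hlt
    refine hdiv.trans_lt (lt_of_le_of_lt (add_le_add_left ?_ _) hlt)
    exact mul_le_of_le_one_right' ENNReal.div_self_le_one
end
end
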